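/- arXiv:2204.11581 — 11 statements merged into one kernel-verified Lean document; each statement's English description precedes it below -/
import Mathlib

section
/- Let S be a locally profinite monoid and let S' ⊆ S be a submonoid. Then S' is open in S if and only if S' contains an open subgroup of S. -/
/-- A locally profinite monoid: a topological monoid containing an open subgroup which is a
profinite group, and such that left and right translates of open sets are open. -/
structure IsLocallyProfiniteMonoid (S : Type*) [Monoid S] [TopologicalSpace S] : Prop where
  exists_open_profinite_subgroup :
    ∃ G : Submonoid S, IsOpen (G : Set S) ∧
      (∀ x ∈ G, ∃ y ∈ G, x * y = 1 ∧ y * x = 1) ∧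
      CompactSpace G ∧ T2Space G ∧ TotallyDisconnectedSpace G
  isOpen_mul_left : ∀ (s : S) (O : Set S), IsOpen O → IsOpen ((s * ·) '' O)
  isOpen_mul_right : ∀ (s : S) (O : Set S), IsOpen O → IsOpen ((· * s) '' O)

theorem aux_inv_mem {M : Type*} [Monoid M] [TopologicalSpace M] [CompactSpace M] [T2Space M]
    (hl : ∀ a : M, Continuous (fun x => a * x)) (hr : ∀ a : M, Continuous (fun x => x * a))
    (hinv : ∀ x : M, ∃ y : M, x * y = 1 ∧ y * x = 1)
    (T : Submonoid M) (hT : IsOpen (T : Set M)) (x y : M) (hx : x ∈ T) (hxy : x * y = 1) :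
    y ∈ T := by
  set P : Set M := Set.range (fun n : ℕ => y ^ (n + 1)) with hP
  have hmul : ∀ a ∈ closure P, ∀ b ∈ closure P, a * b ∈ closure P := by
    have h1 : ∀ a ∈ P, ∀ b ∈ closure P, a * b ∈ closure P := by
      rintro _ ⟨n, rfl⟩ b hb
      refine map_mem_closure (hl (y ^ (n + 1))) hb ?_
      rintro _ ⟨m, rfl⟩
      refine ⟨n + 1 + m, ?_⟩
      simp only [← pow_add]
      congr 1
    intro a ha b hb
    have := map_mem_closure (hr b) ha (fun a ha => h1 a ha b hb)
    rwa [closure_closure] at this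
  obtain ⟨e, he, hee⟩ := exists_idempotent_in_compact_subsemigroup hr (closure P)
    ((Set.range_nonempty _).closure) isClosed_closure.isCompact hmul
  have he1 : e = 1 := by
    obtain ⟨f, hf, hf'⟩ := hinv e
    calc e = e * (e * f) := by rw [hf, mul_one]
      _ = 1 := by rw [← mul_assoc, hee, hf]
  subst he1
  obtain ⟨_, hz, ⟨n, rfl⟩⟩ := mem_closure_iff.1 he T hT T.one_mem
  have key : ∀ k : ℕ, x ^ k * y ^ (k + 1) = y := by
    intro k
    induction k with
    | zero => simp
    | succ k ih =>
      rw [pow_succ x, pow_succ' y (k + 1), mul_assoc, ← mul_assoc x, hxy, one_mul, ih]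
  rw [← key n]
  exact T.mul_mem (T.pow_mem hx n) hz

/-- A submonoid of a locally profinite monoid is open iff it contains an open subgroup. -/
theorem submonoid_isOpen_iff_exists_open_subgroup
    {S : Type*} [Monoid S] [TopologicalSpace S]
    (hS : IsLocallyProfiniteMonoid S) (S' : Submonoid S) :
    IsOpen (S' : Set S) ↔
      ∃ G : Submonoid S, IsOpen (G : Set S) ∧
        (∀ x ∈ G, ∃ y ∈ G, x * y = 1 ∧ y * x = 1) ∧
        (G : Set S) ⊆ (S' : Set S) := by
  constructor
  · intro hS'
    obtain ⟨G, hG, hGi, hc, ht, -⟩ := hS.exists_open_profinite_subgroup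
    refine ⟨G ⊓ S', hG.inter hS', ?_, fun x hx => hx.2⟩
    have hl : ∀ a : G, Continuous (fun x => a * x) := by
      rintro ⟨a, ha⟩
      obtain ⟨b, hb, hab, hba⟩ := hGi a ha
      refine continuous_induced_rng.2 (continuous_def.2 fun O hO => ?_)
      refine ⟨_, hS.isOpen_mul_left b O hO, ?_⟩
      ext ⟨z, hz⟩
      simp only [Set.mem_preimage, Set.mem_image, Function.comp, Submonoid.coe_mul]
      constructor
      · rintro ⟨w, hw, rfl⟩
        rwa [← mul_assoc, hab, one_mul]
      · intro h
        exact ⟨_, h, by rw [← mul_assoc, hba, one_mul]⟩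
    have hr : ∀ a : G, Continuous (fun x => x * a) := by
      rintro ⟨a, ha⟩
      obtain ⟨b, hb, hab, hba⟩ := hGi a ha
      refine continuous_induced_rng.2 (continuous_def.2 fun O hO => ?_)
      refine ⟨_, hS.isOpen_mul_right b O hO, ?_⟩
      ext ⟨z, hz⟩
      simp only [Set.mem_preimage, Set.mem_image, Function.comp, Submonoid.coe_mul]
      constructor
      · rintro ⟨w, hw, rfl⟩
        rwa [mul_assoc, hba, mul_one]
      · intro h
        exact ⟨_, h, by rw [mul_assoc, hab, mul_one]⟩
    rintro x ⟨hx, hx'⟩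
    obtain ⟨y, hy, hxy, hyx⟩ := hGi x hx
    refine ⟨y, ⟨hy, ?_⟩, hxy, hyx⟩
    refine aux_inv_mem hl hr ?_ (S'.comap G.subtype)
      (hS'.preimage continuous_subtype_val) ⟨x, hx⟩ ⟨y, hy⟩ hx' (Subtype.ext hxy)
    rintro ⟨a, ha⟩
    obtain ⟨b, hb, hab, hba⟩ := hGi a ha
    exact ⟨⟨b, hb⟩, Subtype.ext hab, Subtype.ext hba⟩
  · rintro ⟨G, hG, -, hGS⟩
    refine isOpen_iff_forall_mem_open.2 fun s hs => ⟨_, ?_, hS.isOpen_mul_left s G hG, ?_⟩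
    · rintro _ ⟨g, hg, rfl⟩
      exact S'.mul_mem hs (hGS hg)
    · exact ⟨1, G.one_mem, mul_one s⟩
end

section
/- Let k be a field, S a locally profinite monoid and S' ⊆ S a closed submonoid. For a smooth k[S']-module W, let Ind_{S'}^S W denote the set of smooth vectors of Hom_{k[S']}(k[S], W), where k[S] is a k[S']-module via left multiplication and S acts on such homomorphisms by (s·f)(x) = f(x·s); this is a smooth k[S]-module. Then for every smooth k[S]-module V, the map sending a k[S']-linear map φ : V → W to the map v ↦ (x ↦ φ(x·v)) is a well-defined bijection from Hom_{k[S']}(V, W) onto Hom_{k[S]}(V, Ind_{S'}^S W) (Frobenius reciprocity: smooth induction is right adjoint to restriction). -/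
/-- Frobenius reciprocity: smooth induction from a closed submonoid `S'` of a locally profinite
monoid `S` is right adjoint to restriction.  Modules are encoded as representations on
`k`-vector spaces; `Ind_{S'}^S W` is encoded as the set of those `k`-linear maps
`f : k[S] → W` that are `k[S']`-equivariant (`f (s' * x) = s' • f x`) and smooth for the
`S`-action `(s • f) x = f (x * s)`.  The canonical map `φ ↦ (v ↦ (x ↦ φ (x • v)))` is a
bijection from `Hom_{k[S']}(V, W)` onto `Hom_{k[S]}(V, Ind_{S'}^S W)`. -/
theorem frobenius_reciprocity_smooth_induction
    {k S : Type*} [Field k] [Monoid S] [TopologicalSpace S]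
    (hS : IsLocallyProfiniteMonoid S)
    (S' : Submonoid S) (hS' : IsClosed (S' : Set S))
    {V W : Type*} [AddCommGroup V] [Module k V] [AddCommGroup W] [Module k W]
    (ρV : Representation k S V) (ρW : Representation k S' W)
    (hV : ∀ v : V, IsOpen {s : S | ρV s v = v})
    (hW : ∀ w : W, IsOpen {s' : S' | ρW s' w = w}) :
    ∃ e : {φ : V →ₗ[k] W // ∀ (h : S') (v : V), φ (ρV (h : S) v) = ρW h (φ v)} ≃
        {ψ : V → (MonoidAlgebra k S →ₗ[k] W) //
          (∀ (v : V) (h : S') (x : MonoidAlgebra k S),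
            ψ v (MonoidAlgebra.of k S (h : S) * x) = ρW h (ψ v x)) ∧
          (∀ v : V, IsOpen {s : S | ∀ x : MonoidAlgebra k S,
            ψ v (x * MonoidAlgebra.of k S s) = ψ v x}) ∧
          (∀ v v' : V, ψ (v + v') = ψ v + ψ v') ∧
          (∀ (c : k) (v : V), ψ (c • v) = c • ψ v) ∧
          (∀ (s : S) (v : V) (x : MonoidAlgebra k S),
            ψ (ρV s v) x = ψ v (x * MonoidAlgebra.of k S s))},
      ∀ (φ) (v : V) (x : MonoidAlgebra k S),
        (e φ).val v x = φ.val (ρV.asAlgebraHom x v) := by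
  refine ⟨{
    toFun := fun φ => ⟨fun v => φ.val ∘ₗ (ρV.asAlgebraHom.toLinearMap.flip v), ?_, ?_, ?_, ?_, ?_⟩
    invFun := fun ψ => ⟨{ toFun := fun v => ψ.val v 1
                          map_add' := ?_
                          map_smul' := ?_ }, ?_⟩
    left_inv := ?_
    right_inv := ?_ }, ?_⟩
  · intro v h x
    simp [φ.2]
  · intro v
    rw [isOpen_iff_forall_mem_open]
    intro s hs
    refine ⟨(s * ·) '' {u : S | ρV u v = v}, ?_, hS.isOpen_mul_left s _ (hV v), ⟨1, by simp, by simp⟩⟩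
    rintro _ ⟨u, hu, rfl⟩ x
    have h1 := hs x
    simp only [Set.mem_setOf_eq] at hu
    simpa [hu] using h1
  · intro v v'
    ext x
    simp
  · intro c v
    ext x
    simp
  · intro s v x
    simp
  · intro v v'
    simp [ψ.2.2.2.1]
  · intro c v
    simp [ψ.2.2.2.2.1]
  · intro h v
    have h1 := ψ.2.1 v h 1
    have h2 := ψ.2.2.2.2.2 h v 1
    rw [mul_one] at h1
    rw [one_mul] at h2
    exact h2.trans h1
  · intro φ
    ext v
    simp
  · intro ψ
    apply Subtype.ext
    funext v
    apply MonoidAlgebra.lhom_ext'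
    intro s
    ext
    have h2 := ψ.2.2.2.2.2 s v 1
    rw [one_mul] at h2
    simpa using h2
  · intro φ v x
    rfl
end

section
/- Let k be a field, S a locally profinite monoid, and V, W smooth k[S]-modules. Let S act diagonally on k[S] ⊗_k V (so s·(x ⊗ v) = (s·x) ⊗ (s·v)), let S act on Hom_{k[S]}(k[S] ⊗_k V, W) by (s·f)(x ⊗ v) = f((x·s) ⊗ v), and set hom(V, W) := (Hom_{k[S]}(k[S] ⊗_k V, W))^sm, a smooth k[S]-module. Then for every smooth k[S]-module U (with S acting diagonally on U ⊗_k V), the maps φ ↦ (u ↦ (x ⊗ v ↦ φ((x·u) ⊗ v))) and ψ ↦ (u ⊗ v ↦ ψ(u)(1 ⊗ v)) are mutually inverse bijections between Hom_{k[S]}(U ⊗_k V, W) and Hom_{k[S]}(U, hom(V, W)); hence the category of smooth S-representations is closed symmetric monoidal with internal Hom given by hom(V, −). -/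
open scoped TensorProduct

/-- The category of smooth `S`-representations is closed: for smooth `k[S]`-modules `V, W`,
the internal hom `hom(V, W)` is the set of smooth vectors of `Hom_{k[S]}(k[S] ⊗_k V, W)`
(with `S` acting diagonally on `k[S] ⊗_k V`, and on homomorphisms by
`(s • f)(x ⊗ v) = f((x * s) ⊗ v)`), and for every smooth `k[S]`-module `U` the canonical maps
`φ ↦ (u ↦ (x ⊗ v ↦ φ((x • u) ⊗ v)))` and `ψ ↦ (u ⊗ v ↦ ψ(u)(1 ⊗ v))` are mutually inverse
bijections between `Hom_{k[S]}(U ⊗_k V, W)` and `Hom_{k[S]}(U, hom(V, W))`. -/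
theorem tensor_hom_adjunction_smooth
    {k S : Type*} [Field k] [Monoid S] [TopologicalSpace S]
    (hS : IsLocallyProfiniteMonoid S)
    {U V W : Type*} [AddCommGroup U] [Module k U] [AddCommGroup V] [Module k V]
    [AddCommGroup W] [Module k W]
    (ρU : Representation k S U) (ρV : Representation k S V) (ρW : Representation k S W)
    (hU : ∀ u : U, IsOpen {s : S | ρU s u = u})
    (hV : ∀ v : V, IsOpen {s : S | ρV s v = v})
    (hW : ∀ w : W, IsOpen {s : S | ρW s w = w}) :
    ∃ e : {φ : U ⊗[k] V →ₗ[k] W //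
            ∀ (s : S) (t : U ⊗[k] V),
              φ (TensorProduct.map (ρU s) (ρV s) t) = ρW s (φ t)} ≃
          {ψ : U → (MonoidAlgebra k S ⊗[k] V →ₗ[k] W) //
            (∀ (u : U) (s : S) (t : MonoidAlgebra k S ⊗[k] V),
              ψ u (TensorProduct.map (LinearMap.mulLeft k (MonoidAlgebra.of k S s)) (ρV s) t) =
                ρW s (ψ u t)) ∧
            (∀ u : U, IsOpen {s : S | ∀ t : MonoidAlgebra k S ⊗[k] V,
              ψ u (LinearMap.rTensor V (LinearMap.mulRight k (MonoidAlgebra.of k S s)) t) =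
                ψ u t}) ∧
            (∀ u u' : U, ψ (u + u') = ψ u + ψ u') ∧
            (∀ (c : k) (u : U), ψ (c • u) = c • ψ u) ∧
            (∀ (s : S) (u : U) (t : MonoidAlgebra k S ⊗[k] V),
              ψ (ρU s u) t =
                ψ u (LinearMap.rTensor V (LinearMap.mulRight k (MonoidAlgebra.of k S s)) t))},
      (∀ (φ) (u : U) (x : MonoidAlgebra k S) (v : V),
        (e φ).val u (x ⊗ₜ[k] v) = φ.val (ρU.asAlgebraHom x u ⊗ₜ[k] v)) ∧
      (∀ (ψ) (u : U) (v : V),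
        (e.symm ψ).val (u ⊗ₜ[k] v) = ψ.val u ((1 : MonoidAlgebra k S) ⊗ₜ[k] v)) := by
  have hx : ∀ (ψ : U → (MonoidAlgebra k S ⊗[k] V →ₗ[k] W)),
      (∀ u u' : U, ψ (u + u') = ψ u + ψ u') → (∀ (c : k) (u : U), ψ (c • u) = c • ψ u) →
      (∀ (s : S) (u : U) (t : MonoidAlgebra k S ⊗[k] V),
        ψ (ρU s u) t =
          ψ u (LinearMap.rTensor V (LinearMap.mulRight k (MonoidAlgebra.of k S s)) t)) →
      ∀ (u : U) (x : MonoidAlgebra k S) (v : V),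
        ψ (ρU.asAlgebraHom x u) ((1 : MonoidAlgebra k S) ⊗ₜ[k] v) = ψ u (x ⊗ₜ[k] v) := by
    intro ψ h1 h2 h3 u x v
    induction x using MonoidAlgebra.induction_on with
    | of s =>
      rw [Representation.asAlgebraHom_of, h3, LinearMap.rTensor_tmul, LinearMap.mulRight_apply,
        one_mul]
    | add x y hx hy =>
      rw [map_add, LinearMap.add_apply, h1, LinearMap.add_apply, hx, hy, TensorProduct.add_tmul,
        map_add]
    | smul c x hx =>
      rw [map_smul, LinearMap.smul_apply, h2, LinearMap.smul_apply, hx,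
        ← TensorProduct.smul_tmul', map_smul]
  let F : (U ⊗[k] V →ₗ[k] W) → U → (MonoidAlgebra k S ⊗[k] V →ₗ[k] W) := fun φ u =>
    φ ∘ₗ LinearMap.rTensor V ((LinearMap.applyₗ u) ∘ₗ ρU.asAlgebraHom.toLinearMap)
  have hF : ∀ φ u x v, F φ u (x ⊗ₜ[k] v) = φ (ρU.asAlgebraHom x u ⊗ₜ[k] v) := by
    intro φ u x v
    simp [F]
  have hF5 : ∀ φ (s : S) (u : U) (t : MonoidAlgebra k S ⊗[k] V), F φ (ρU s u) t =
      F φ u (LinearMap.rTensor V (LinearMap.mulRight k (MonoidAlgebra.of k S s)) t) := by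
    intro φ s u t
    induction t using TensorProduct.induction_on with
    | zero => simp only [map_zero]
    | add a b ha hb => simp only [map_add, ha, hb]
    | tmul x v =>
      rw [LinearMap.rTensor_tmul, hF, hF, LinearMap.mulRight_apply, map_mul,
        Representation.asAlgebraHom_of]
      rfl
  let G : (ψ : U → (MonoidAlgebra k S ⊗[k] V →ₗ[k] W)) →
      (∀ u u' : U, ψ (u + u') = ψ u + ψ u') → (∀ (c : k) (u : U), ψ (c • u) = c • ψ u) →
      (U ⊗[k] V →ₗ[k] W) := fun ψ h1 h2 =>
    TensorProduct.lift
      ((LinearMap.lcomp k W (TensorProduct.mk k (MonoidAlgebra k S) V 1)) ∘ₗ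
        ({ toFun := ψ, map_add' := h1, map_smul' := h2 } :
          U →ₗ[k] (MonoidAlgebra k S ⊗[k] V →ₗ[k] W)))
  have hG : ∀ ψ h1 h2 u v, G ψ h1 h2 (u ⊗ₜ[k] v) = ψ u ((1 : MonoidAlgebra k S) ⊗ₜ[k] v) := by
    intro ψ h1 h2 u v
    simp [G]
  refine ⟨{ toFun := fun φ => ⟨F φ.1, ?_, ?_, ?_, ?_, hF5 φ.1⟩
            invFun := fun ψ => ⟨G ψ.1 ψ.2.2.2.1 ψ.2.2.2.2.1, ?_⟩
            left_inv := ?_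
            right_inv := ?_ }, ?_, ?_⟩
  · intro u s t
    induction t using TensorProduct.induction_on with
    | zero => simp only [map_zero]
    | add a b ha hb => simp only [map_add, ha, hb]
    | tmul x v =>
      rw [TensorProduct.map_tmul, hF, hF, LinearMap.mulLeft_apply, map_mul,
        Representation.asAlgebraHom_of, ← φ.2, TensorProduct.map_tmul]
      rfl
  · intro u
    rw [isOpen_iff_forall_mem_open]
    intro s hs
    refine ⟨(s * ·) '' {s : S | ρU s u = u}, ?_, hS.isOpen_mul_left s _ (hU u),
      ⟨1, by simp, by simp⟩⟩
    rintro _ ⟨h, hh, rfl⟩ t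
    have hs' := hs t
    rw [← hF5] at hs' ⊢
    have hh' : ρU h u = u := hh
    simp only [map_mul, Module.End.mul_apply, hh']
    exact hs'
  · intro u u'
    apply TensorProduct.ext'
    intro x v
    simp only [LinearMap.add_apply, hF, map_add, TensorProduct.add_tmul]
  · intro c u
    apply TensorProduct.ext'
    intro x v
    rw [LinearMap.smul_apply, hF, hF, map_smul, ← TensorProduct.smul_tmul', map_smul]
  · intro s t
    induction t using TensorProduct.induction_on with
    | zero => simp only [map_zero]
    | add a b ha hb => simp only [map_add, ha, hb]
    | tmul u v =>
      rw [TensorProduct.map_tmul, hG, hG, ψ.2.2.2.2.2, ← ψ.2.1, LinearMap.rTensor_tmul,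
        TensorProduct.map_tmul, LinearMap.mulLeft_apply, LinearMap.mulRight_apply, one_mul,
        mul_one]
  · intro φ
    apply Subtype.ext
    apply TensorProduct.ext'
    intro u v
    refine (hG _ _ _ u v).trans ?_
    refine (hF _ _ _ _).trans ?_
    rw [map_one]
    rfl
  · intro ψ
    apply Subtype.ext
    funext u
    apply TensorProduct.ext'
    intro x v
    refine (hF _ _ _ _).trans ?_
    refine (hG _ _ _ _ _).trans ?_
    exact hx ψ.1 ψ.2.2.2.1 ψ.2.2.2.2.1 ψ.2.2.2.2.2 u x v
  · intro φ u x v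
    exact hF _ _ _ _
  · intro ψ u v
    exact hG _ _ _ _ _
end

section
/- Let k be a field and f : S → T a surjective open continuous homomorphism of locally profinite monoids. For a smooth k[T]-module W, let Inf W denote W regarded as a smooth k[S]-module via f. For a smooth k[S]-module V, let Π_U(V) := (Hom_{k[S]}(k[T], V))^sm, where k[T] is a k[S]-module via left multiplication through f and T acts on Hom_{k[S]}(k[T], V) by (t·g)(x) = g(x·t). Then the map sending a k[S]-linear map ψ : Inf W → V to the map w ↦ (t ↦ ψ(t·w)) is a well-defined bijection from Hom_{k[S]}(Inf W, V) onto Hom_{k[T]}(W, Π_U(V)); that is, Π_U is right adjoint to the inflation functor along f. -/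
/-- Let `f : S → T` be a surjective open continuous homomorphism of locally profinite monoids.
For a smooth `k[S]`-module `V`, the representation `Π_U(V)` is the set of smooth vectors of
`Hom_{k[S]}(k[T], V)` (where `k[T]` is a `k[S]`-module via left multiplication through `f`, and
`T` acts by `(t • g)(x) = g(x * t)`).  The map `ψ ↦ (w ↦ (t ↦ ψ(t • w)))` is a bijection from
`Hom_{k[S]}(Inf W, V)` onto `Hom_{k[T]}(W, Π_U(V))`; i.e. `Π_U` is right adjoint to inflation
along `f`. -/
theorem inflation_right_adjoint
    {k S T : Type*} [Field k] [Monoid S] [TopologicalSpace S] [Monoid T] [TopologicalSpace T]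
    (hS : IsLocallyProfiniteMonoid S) (hT : IsLocallyProfiniteMonoid T)
    (f : S →* T) (hfcont : Continuous f) (hfopen : IsOpenMap f)
    (hfsurj : Function.Surjective f)
    {V W : Type*} [AddCommGroup V] [Module k V] [AddCommGroup W] [Module k W]
    (ρV : Representation k S V) (ρW : Representation k T W)
    (hV : ∀ v : V, IsOpen {s : S | ρV s v = v})
    (hW : ∀ w : W, IsOpen {t : T | ρW t w = w}) :
    ∃ e : {ψ : W →ₗ[k] V // ∀ (s : S) (w : W), ψ (ρW (f s) w) = ρV s (ψ w)} ≃
        {Ψ : W → (MonoidAlgebra k T →ₗ[k] V) //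
          (∀ (w : W) (s : S) (x : MonoidAlgebra k T),
            Ψ w (MonoidAlgebra.of k T (f s) * x) = ρV s (Ψ w x)) ∧
          (∀ w : W, IsOpen {t : T | ∀ x : MonoidAlgebra k T,
            Ψ w (x * MonoidAlgebra.of k T t) = Ψ w x}) ∧
          (∀ w w' : W, Ψ (w + w') = Ψ w + Ψ w') ∧
          (∀ (c : k) (w : W), Ψ (c • w) = c • Ψ w) ∧
          (∀ (t : T) (w : W) (x : MonoidAlgebra k T),
            Ψ (ρW t w) x = Ψ w (x * MonoidAlgebra.of k T t))},
      ∀ (ψ) (w : W) (t : T),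
        (e ψ).val w (MonoidAlgebra.of k T t) = ψ.val (ρW t w) := by
  let F : (W →ₗ[k] V) → W → (MonoidAlgebra k T →ₗ[k] V) := fun ψ w =>
    ψ ∘ₗ (LinearMap.applyₗ w) ∘ₗ ρW.asAlgebraHom.toLinearMap
  have hF : ∀ ψ w x, F ψ w x = ψ (ρW.asAlgebraHom x w) := fun ψ w x => rfl
  have hof : ∀ t, ρW.asAlgebraHom (MonoidAlgebra.of k T t) = ρW t :=
    fun t => Representation.asAlgebraHom_of ρW t
  refine ⟨⟨fun ψ => ⟨F ψ.1, ?_, ?_, ?_, ?_, ?_⟩,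
    fun Ψ => ⟨⟨⟨fun w => Ψ.1 w 1, ?_⟩, ?_⟩, ?_⟩, ?_, ?_⟩, ?_⟩
  · intro w s x
    rw [hF, hF, map_mul, hof, Module.End.mul_apply, ψ.2]
  · intro w
    rw [isOpen_iff_forall_mem_open]
    intro t ht
    refine ⟨_, ?_, hT.isOpen_mul_left t _ (hW w), ⟨1, by simp, by simp⟩⟩
    rintro _ ⟨u, hu, rfl⟩ x
    have h1 := ht x
    rw [hF, hF, map_mul, hof, Module.End.mul_apply] at h1
    have hu' : ρW u w = w := hu
    change F ψ.1 w (x * MonoidAlgebra.of k T (t * u)) = _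
    rw [hF, hF, map_mul, hof, Module.End.mul_apply, map_mul, Module.End.mul_apply, hu', h1]
  · intro w w'
    refine LinearMap.ext fun x => ?_
    simp only [hF, map_add, map_smul, LinearMap.add_apply, LinearMap.smul_apply]
  · intro c w
    refine LinearMap.ext fun x => ?_
    simp only [hF, map_add, map_smul, LinearMap.add_apply, LinearMap.smul_apply]
  · intro t w x
    rw [hF, hF, map_mul, hof, Module.End.mul_apply]
  · intro w w'
    rw [Ψ.2.2.2.1]; rfl
  · intro c w
    change Ψ.1 (c • w) 1 = c • Ψ.1 w 1
    rw [Ψ.2.2.2.2.1]; rfl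
  · intro s w
    change Ψ.1 (ρW (f s) w) 1 = ρV s (Ψ.1 w 1)
    rw [Ψ.2.2.2.2.2, ← Ψ.2.1, one_mul, mul_one]
  · intro ψ
    apply Subtype.ext
    ext w
    change F ψ.1 w 1 = ψ.1 w
    rw [hF, map_one, Module.End.one_apply]
  · intro Ψ
    apply Subtype.ext
    funext w
    refine LinearMap.ext fun x => ?_
    change Ψ.1 (ρW.asAlgebraHom x w) 1 = Ψ.1 w x
    induction x using MonoidAlgebra.induction_on with
    | of t => rw [hof, Ψ.2.2.2.2.2, one_mul]
    | add x y hx hy => rw [map_add, LinearMap.add_apply, Ψ.2.2.2.1, LinearMap.add_apply, hx, hy, map_add]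
    | smul c x hx => rw [map_smul, LinearMap.smul_apply, Ψ.2.2.2.2.1, LinearMap.smul_apply, hx, map_smul]
  · intro ψ w t
    change F ψ.1 w _ = _
    rw [hF, hof]
end

section
/- Let k be a field, f : S → T a surjective homomorphism of monoids, and U := f⁻¹(1) its kernel. Assume f⁻¹(f(s)) = U·s for every s ∈ S. Then: (i) the kernel of the induced k-algebra homomorphism of monoid algebras k[S] → k[T] is the right ideal of k[S] generated by the elements u − 1 for u ∈ U; (ii) for every k[S]-module V, writing V(U) for the k-linear span of {u·v − v : u ∈ U, v ∈ V}, the map V/V(U) → k[T] ⊗_{k[S]} V sending the class of v to 1 ⊗ v is a bijection. -/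
open scoped TensorProduct

noncomputable def coinvLift {k T M : Type*} [Field k] [AddCommGroup M] [Module k M] (φ : T → M) :
    MonoidAlgebra k T →ₗ[k] M :=
  Finsupp.linearCombination k φ ∘ₗ (MonoidAlgebra.coeffLinearEquiv k).toLinearMap

theorem coinvLift_single {k T M : Type*} [Field k] [AddCommGroup M] [Module k M] (φ : T → M)
    (t : T) (c : k) : coinvLift φ (MonoidAlgebra.single t c) = c • φ t := by
  simp [coinvLift]

/-- Let `f : S → T` be a surjective homomorphism of monoids with kernel `U`, such that every
fiber of `f` is a left `U`-coset: `f⁻¹(f(s)) = U·s`.  Then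
(i) the kernel of the induced map of monoid algebras `k[S] → k[T]` is the right ideal
generated by the elements `u - 1` for `u ∈ U` (realized as the `k`-span of the elements
`(u - 1) * x`), and
(ii) for every `k[S]`-module `V` (encoded as a representation of `S` on a `k`-vector space),
the map `V/V(U) → k[T] ⊗_{k[S]} V`, sending the class of `v` to `1 ⊗ v`, is a bijection,
where `V(U)` is the `k`-span of `{u • v - v}` and the tensor product over the (possibly
noncommutative) ring `k[S]` is realized as the quotient of `k[T] ⊗_k V` by the `k`-span of the
elements `(x * f s) ⊗ v - x ⊗ (s • v)`. -/
theorem coinvariants_of_inflation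
    {k S T : Type*} [Field k] [Monoid S] [Monoid T]
    (f : S →* T) (hfsurj : Function.Surjective f)
    (hfiber : ∀ s s' : S, f s' = f s ↔ ∃ u : S, f u = 1 ∧ s' = u * s)
    {V : Type*} [AddCommGroup V] [Module k V] (ρ : Representation k S V) :
    (∀ a : MonoidAlgebra k S,
      MonoidAlgebra.mapDomainRingHom k f a = 0 ↔
        a ∈ Submodule.span k
          {z : MonoidAlgebra k S | ∃ (u : S) (x : MonoidAlgebra k S),
            f u = 1 ∧ z = (MonoidAlgebra.of k S u - 1) * x}) ∧
    ∃ e : (V ⧸ Submodule.span k {z : V | ∃ (u : S) (v : V), f u = 1 ∧ z = ρ u v - v}) ≃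
        ((MonoidAlgebra k T ⊗[k] V) ⧸
          Submodule.span k
            {t : MonoidAlgebra k T ⊗[k] V | ∃ (x : MonoidAlgebra k T) (s : S) (v : V),
              t = (x * MonoidAlgebra.of k T (f s)) ⊗ₜ[k] v - x ⊗ₜ[k] ρ s v}),
      ∀ v : V, e (Submodule.Quotient.mk v) =
        Submodule.Quotient.mk ((1 : MonoidAlgebra k T) ⊗ₜ[k] v) := by
  obtain ⟨σ, hσ⟩ := hfsurj.hasRightInverse
  constructor
  · intro a
    constructor
    · intro ha
      let g : MonoidAlgebra k T →ₗ[k] MonoidAlgebra k S :=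
        coinvLift fun t => MonoidAlgebra.of k S (σ t)
      have key : ∀ a : MonoidAlgebra k S, a - g (MonoidAlgebra.mapDomainRingHom k f a) ∈
          Submodule.span k {z : MonoidAlgebra k S | ∃ (u : S) (x : MonoidAlgebra k S),
            f u = 1 ∧ z = (MonoidAlgebra.of k S u - 1) * x} := by
        intro a
        induction a using MonoidAlgebra.induction_linear with
        | zero => simp
        | add x y hx hy =>
          have := Submodule.add_mem _ hx hy
          rw [map_add, map_add]
          convert this using 1
          abel
        | single s c =>
          obtain ⟨u, hu, hs⟩ := (hfiber (σ (f s)) s).1 (hσ (f s)).symm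
          refine Submodule.subset_span ⟨u, MonoidAlgebra.single (σ (f s)) c, hu, ?_⟩
          have h1 : MonoidAlgebra.mapDomainRingHom k f (MonoidAlgebra.single s c) =
            MonoidAlgebra.single (f s) c := by simp
          rw [h1]
          simp only [g, coinvLift_single]
          rw [sub_mul, one_mul]
          simp [MonoidAlgebra.of_apply, ← hs]
      have := key a
      rwa [ha, map_zero, sub_zero] at this
    · intro ha
      induction ha using Submodule.span_induction with
      | mem z hz =>
        obtain ⟨u, x, hu, rfl⟩ := hz
        rw [map_mul, map_sub, map_one]
        simp [MonoidAlgebra.of_apply, hu, MonoidAlgebra.one_def]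
      | zero => simp
      | add x y _ _ hx hy => rw [map_add, hx, hy, add_zero]
      | smul c x _ hx =>
        have : c • x = MonoidAlgebra.single 1 c * x := by
          have h2 : (MonoidAlgebra.single 1 c : MonoidAlgebra k S) = c • 1 := by
            simp [MonoidAlgebra.one_def]
          rw [h2, smul_mul_assoc, one_mul]
        rw [this, map_mul, hx, mul_zero]
  · set P := Submodule.span k {z : V | ∃ (u : S) (v : V), f u = 1 ∧ z = ρ u v - v} with hP
    set Q := Submodule.span k
            {t : MonoidAlgebra k T ⊗[k] V | ∃ (x : MonoidAlgebra k T) (s : S) (v : V),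
              t = (x * MonoidAlgebra.of k T (f s)) ⊗ₜ[k] v - x ⊗ₜ[k] ρ s v} with hQ
    have hPeq : ∀ (s s' : S) (v : V), f s' = f s → P.mkQ (ρ s' v) = P.mkQ (ρ s v) := by
      intro s s' v h
      obtain ⟨u, hu, rfl⟩ := (hfiber s s').1 h
      rw [← sub_eq_zero, ← map_sub, Submodule.mkQ_apply, Submodule.Quotient.mk_eq_zero]
      exact Submodule.subset_span ⟨u, ρ s v, hu, by simp⟩
    have hQeq : ∀ (x : MonoidAlgebra k T) (s : S) (v : V),
        Q.mkQ ((x * MonoidAlgebra.of k T (f s)) ⊗ₜ[k] v) = Q.mkQ (x ⊗ₜ[k] ρ s v) := by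
      intro x s v
      rw [← sub_eq_zero, ← map_sub, Submodule.mkQ_apply, Submodule.Quotient.mk_eq_zero]
      exact Submodule.subset_span ⟨x, s, v, rfl⟩
    let F : (V ⧸ P) →ₗ[k] ((MonoidAlgebra k T ⊗[k] V) ⧸ Q) :=
      P.liftQ (Q.mkQ ∘ₗ TensorProduct.mk k (MonoidAlgebra k T) V 1) (by
        rw [hP, Submodule.span_le]
        rintro _ ⟨u, v, hu, rfl⟩
        have := hQeq 1 u v
        rw [hu, map_one, one_mul] at this
        simp only [SetLike.mem_coe, LinearMap.mem_ker, map_sub, LinearMap.comp_apply,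
          TensorProduct.mk_apply]
        rw [this, sub_self])
    let G0 : MonoidAlgebra k T →ₗ[k] V →ₗ[k] (V ⧸ P) := coinvLift fun t => P.mkQ ∘ₗ ρ (σ t)
    have hG0 : ∀ t c v, G0 (MonoidAlgebra.single t c) v = c • P.mkQ (ρ (σ t) v) := by
      intro t c v
      simp only [G0, coinvLift_single]
      rfl
    let G : ((MonoidAlgebra k T ⊗[k] V) ⧸ Q) →ₗ[k] (V ⧸ P) :=
      Q.liftQ (TensorProduct.lift G0) (by
        rw [hQ, Submodule.span_le]
        rintro _ ⟨x, s, v, rfl⟩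
        simp only [SetLike.mem_coe, LinearMap.mem_ker, map_sub, TensorProduct.lift.tmul]
        rw [sub_eq_zero]
        induction x using MonoidAlgebra.induction_linear with
        | zero => simp
        | add x y hx hy => rw [add_mul, map_add, map_add, LinearMap.add_apply,
            LinearMap.add_apply, hx, hy]
        | single t c =>
          rw [MonoidAlgebra.of_apply, MonoidAlgebra.single_mul_single, hG0, hG0, mul_one,
            hPeq (σ t * s) (σ (t * f s)) v (by rw [hσ, map_mul, hσ]), map_mul]
          rfl)
    refine ⟨⟨F, G, ?_, ?_⟩, fun v => rfl⟩
    · intro y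
      obtain ⟨v, rfl⟩ := P.mkQ_surjective y
      change G0 1 v = _
      rw [MonoidAlgebra.one_def, hG0, one_smul, hPeq 1 (σ 1) v (by rw [hσ, map_one]), map_one]
      rfl
    · intro y
      have : F ∘ₗ G = LinearMap.id := by
        apply Submodule.linearMap_qext
        apply TensorProduct.ext'
        intro x v
        change F (G0 x v) = Q.mkQ (x ⊗ₜ v)
        induction x using MonoidAlgebra.induction_linear with
        | zero => simp
        | add x y hx hy => rw [map_add, LinearMap.add_apply, map_add, hx, hy,
            TensorProduct.add_tmul, map_add]
        | single t c =>
          rw [hG0, map_smul]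
          change c • Q.mkQ ((1 : MonoidAlgebra k T) ⊗ₜ[k] ρ (σ t) v) = _
          rw [← hQeq, one_mul, hσ, ← map_smul, TensorProduct.smul_tmul']
          simp [MonoidAlgebra.of_apply]
      exact LinearMap.congr_fun this y
end

section
/- Let f : S → T be a surjective homomorphism of monoids with kernel U := f⁻¹(1). Let H_S ⊆ S be a submonoid that is a group, and H_T := f(H_S). Assume that f induces a bijection H_S\S → H_T\T of left coset spaces, i.e., for all s, s' ∈ S one has s' ∈ H_S·s if and only if f(s') ∈ H_T·f(s). Then s·U ⊆ H_S·s for every s ∈ S (for every u ∈ U there exists h ∈ H_S with s·u = h·s); in particular U ⊆ H_S, and U is a group, i.e., every element of U has a two-sided inverse lying in U. -/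
/-- Let `f : S → T` be a surjective monoid homomorphism with kernel `U = f⁻¹(1)`, and let
`H` be a submonoid of `S` that is a group, with image `H_T = f(H)`.  If `f` induces a
bijection of left coset spaces `H\S → H_T\T`, then `s·U ⊆ H·s` for every `s`; in particular
`U ⊆ H`, and `U` is a group (every element of `U` has a two-sided inverse lying in `U`). -/
theorem kernel_subset_of_coset_bijection
    {S T : Type*} [Monoid S] [Monoid T] (f : S →* T)
    (hfsurj : Function.Surjective f)
    (H : Submonoid S) (hHgrp : ∀ x ∈ H, ∃ y ∈ H, x * y = 1 ∧ y * x = 1)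
    (hcoset : ∀ s s' : S, (∃ h ∈ H, s' = h * s) ↔ ∃ t ∈ H.map f, f s' = t * f s) :
    (∀ (s u : S), f u = 1 → ∃ h ∈ H, s * u = h * s) ∧
    (∀ u : S, f u = 1 → u ∈ H) ∧
    (∀ u : S, f u = 1 → ∃ v : S, f v = 1 ∧ u * v = 1 ∧ v * u = 1) := by
  have h1 : ∀ (s u : S), f u = 1 → ∃ h ∈ H, s * u = h * s := by
    intro s u hu
    exact (hcoset s (s * u)).2 ⟨1, one_mem _, by rw [map_mul, hu, mul_one, one_mul]⟩
  have h2 : ∀ u : S, f u = 1 → u ∈ H := by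
    intro u hu
    obtain ⟨h, hh, e⟩ := h1 1 u hu
    rw [one_mul, mul_one] at e
    rwa [e]
  refine ⟨h1, h2, ?_⟩
  intro u hu
  obtain ⟨v, -, huv, hvu⟩ := hHgrp u (h2 u hu)
  refine ⟨v, ?_, huv, hvu⟩
  have := congrArg f huv
  rwa [map_mul, hu, one_mul, map_one] at this
end

section
/- Let f : S → T be a surjective homomorphism of monoids with kernel U := f⁻¹(1). Let H_S ⊆ S and K_S ⊆ S be submonoids that are groups, and set H_T := f(H_S), K_T := f(K_S). Assume that for all s, s' ∈ S one has s' ∈ H_S·s if and only if f(s') ∈ H_T·f(s). Then f induces a bijection of double coset spaces H_S\S/K_S → H_T\T/K_T; explicitly, for all s, s' ∈ S, s' ∈ H_S·s·K_S if and only if f(s') ∈ H_T·f(s)·K_T. -/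
/-- Let `f : S → T` be a surjective monoid homomorphism with kernel `U = f⁻¹(1)`, and let
`H, K` be submonoids of `S` that are groups, with images `H_T = f(H)`, `K_T = f(K)`.  If `f`
induces a bijection of left coset spaces `H\S → H_T\T`, then `f` induces a bijection of double
coset spaces `H\S/K → H_T\T/K_T`: for all `s, s'`, one has `s' ∈ H·s·K` iff
`f s' ∈ H_T·(f s)·K_T`. -/
theorem double_coset_bijection
    {S T : Type*} [Monoid S] [Monoid T] (f : S →* T)
    (hfsurj : Function.Surjective f)
    (H K : Submonoid S)
    (hHgrp : ∀ x ∈ H, ∃ y ∈ H, x * y = 1 ∧ y * x = 1)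
    (hKgrp : ∀ x ∈ K, ∃ y ∈ K, x * y = 1 ∧ y * x = 1)
    (hcoset : ∀ s s' : S, (∃ h ∈ H, s' = h * s) ↔ ∃ t ∈ H.map f, f s' = t * f s) :
    ∀ s s' : S,
      (∃ h ∈ H, ∃ κ ∈ K, s' = h * s * κ) ↔
        ∃ t ∈ H.map f, ∃ τ ∈ K.map f, f s' = t * f s * τ := by
  intro s s'
  constructor
  · rintro ⟨h, hh, κ, hκ, rfl⟩
    exact ⟨f h, Submonoid.mem_map_of_mem f hh, f κ, Submonoid.mem_map_of_mem f hκ, by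
      simp only [map_mul]⟩
  · rintro ⟨t, ht, τ, ⟨κ, hκ, rfl⟩, e⟩
    obtain ⟨h, hh, e'⟩ := (hcoset (s * κ) s').2 ⟨t, ht, by rw [e, map_mul, mul_assoc]⟩
    exact ⟨h, hh, κ, hκ, by rw [e', mul_assoc]⟩
end

section
/- Let P be a topological group with subgroups U and M such that U is normal in P, P = U·M and U ∩ M = {1}. Let K_U be a compact open subgroup of U, set M⁺ := {m ∈ M : m·K_U·m⁻¹ ⊆ K_U}, and suppose z is an element of the center of M satisfying z·K_U·z⁻¹ ⊆ K_U and U = ⋃_{n>0} z⁻ⁿ·K_U·zⁿ. Then for every m ∈ M there exists n ≥ 0 with zⁿ·m ∈ M⁺, and for every g ∈ P there exists n ≥ 0 with zⁿ·g ∈ K_U·M⁺. Consequently, M is generated as a monoid by M⁺ together with z⁻¹, and P is generated as a monoid by P⁺ := K_U·M⁺ together with z⁻¹. -/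
/-- Let `P = U ⋊ M` be a topological group (with `U` normal, `P = U·M`, `U ∩ M = 1`), let
`K_U` be a compact open subgroup of `U`, let `M⁺ = {m ∈ M : m K_U m⁻¹ ⊆ K_U}` be the monoid of
positive elements, and let `z` be a strictly positive element (central in `M`, with
`z K_U z⁻¹ ⊆ K_U` and `U = ⋃_{n>0} z⁻ⁿ K_U zⁿ`).  Then every `m ∈ M` satisfies `zⁿ m ∈ M⁺` for
some `n`, every `g ∈ P` satisfies `zⁿ g ∈ K_U·M⁺` for some `n`; consequently `M` is generated
as a monoid by `M⁺` and `z⁻¹`, and `P` is generated as a monoid by `P⁺ = K_U·M⁺` and `z⁻¹`. -/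
theorem generation_by_positive_monoid
    {P : Type*} [Group P] [TopologicalSpace P] [IsTopologicalGroup P]
    (U M : Subgroup P) [U.Normal]
    (hP : ∀ g : P, ∃ u ∈ U, ∃ m ∈ M, g = u * m) (hUM : U ⊓ M = ⊥)
    (K_U : Subgroup P) (hKUle : K_U ≤ U) (hKUcpt : IsCompact (K_U : Set P))
    (hKUopen : IsOpen {u : U | (u : P) ∈ K_U})
    (z : P) (hzM : z ∈ M) (hzcentral : ∀ m ∈ M, z * m = m * z)
    (hzpos : ∀ u ∈ K_U, z * u * z⁻¹ ∈ K_U)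
    (hzU : ∀ g : P, g ∈ U ↔ ∃ n : ℕ, 0 < n ∧ z ^ n * g * (z ^ n)⁻¹ ∈ K_U) :
    (∀ m ∈ M, ∃ n : ℕ,
      z ^ n * m ∈ M ∧ ∀ u ∈ K_U, (z ^ n * m) * u * (z ^ n * m)⁻¹ ∈ K_U) ∧
    (∀ g : P, ∃ n : ℕ, ∃ u ∈ K_U, ∃ m : P,
      (m ∈ M ∧ ∀ u' ∈ K_U, m * u' * m⁻¹ ∈ K_U) ∧ z ^ n * g = u * m) ∧
    Submonoid.closure
      ({m : P | m ∈ M ∧ ∀ u ∈ K_U, m * u * m⁻¹ ∈ K_U} ∪ {z⁻¹}) = M.toSubmonoid ∧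
    Submonoid.closure
      ({g : P | ∃ u ∈ K_U, ∃ m : P,
        (m ∈ M ∧ ∀ u' ∈ K_U, m * u' * m⁻¹ ∈ K_U) ∧ g = u * m} ∪ {z⁻¹}) = ⊤ := by
  have hpow : ∀ k : ℕ, ∀ u ∈ K_U, z ^ k * u * (z ^ k)⁻¹ ∈ K_U := by
    intro k
    induction k with
    | zero => intro u hu; simpa using hu
    | succ k ih =>
      intro u hu
      have h := hzpos _ (ih u hu)
      have e : z ^ (k + 1) * u * (z ^ (k + 1))⁻¹ = z * (z ^ k * u * (z ^ k)⁻¹) * z⁻¹ := by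
        rw [pow_succ']; group
      rw [e]; exact h
  have hmono : ∀ a b : ℕ, a ≤ b → ∀ x : P, z ^ a * x * (z ^ a)⁻¹ ∈ K_U →
      z ^ b * x * (z ^ b)⁻¹ ∈ K_U := by
    intro a b hab x hx
    obtain ⟨c, rfl⟩ := Nat.exists_eq_add_of_le hab
    have h := hpow c _ hx
    have e : z ^ (a + c) * x * (z ^ (a + c))⁻¹
        = z ^ c * (z ^ a * x * (z ^ a)⁻¹) * (z ^ c)⁻¹ := by
      rw [add_comm, pow_add]; group
    rw [e]; exact h
  have hUn : U.Normal := inferInstance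
  have h1 : ∀ m ∈ M, ∃ n : ℕ,
      z ^ n * m ∈ M ∧ ∀ u ∈ K_U, (z ^ n * m) * u * (z ^ n * m)⁻¹ ∈ K_U := by
    intro m hm
    obtain ⟨V, hV, hVK⟩ := isOpen_induced_iff.mp hKUopen
    have hVK' : ∀ x ∈ U, (x ∈ V ↔ x ∈ K_U) := by
      intro x hx
      have := Set.ext_iff.mp hVK ⟨x, hx⟩
      simpa using this
    obtain ⟨t, ht⟩ := hKUcpt.elim_finite_subcover
      (fun n : ℕ => (fun x : P => (z ^ n * m) * x * (z ^ n * m)⁻¹) ⁻¹' V)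
      (fun n => hV.preimage (by fun_prop))
      (by
        intro x hx
        obtain ⟨n, _, hn⟩ := (hzU _).mp (hUn.conj_mem x (hKUle hx) m)
        refine Set.mem_iUnion.mpr ⟨n, ?_⟩
        refine (hVK' _ (hUn.conj_mem x (hKUle hx) _)).mpr ?_
        have e : (z ^ n * m) * x * (z ^ n * m)⁻¹ = z ^ n * (m * x * m⁻¹) * (z ^ n)⁻¹ := by
          group
        rw [e]; exact hn)
    refine ⟨t.sup id, M.mul_mem (M.pow_mem hzM _) hm, ?_⟩
    intro u hu
    obtain ⟨n, hn, hnu⟩ := Set.mem_iUnion₂.mp (ht hu)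
    have hk := (hVK' _ (hUn.conj_mem u (hKUle hu) _)).mp hnu
    have e : ∀ n : ℕ, (z ^ n * m) * u * (z ^ n * m)⁻¹
        = z ^ n * (m * u * m⁻¹) * (z ^ n)⁻¹ := by
      intro n; group
    rw [e] at hk ⊢
    exact hmono n _ (Finset.le_sup (f := id) hn) _ hk
  have h2 : ∀ g : P, ∃ n : ℕ, ∃ u ∈ K_U, ∃ m : P,
      (m ∈ M ∧ ∀ u' ∈ K_U, m * u' * m⁻¹ ∈ K_U) ∧ z ^ n * g = u * m := by
    intro g
    obtain ⟨u, hu, m, hm, rfl⟩ := hP g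
    obtain ⟨a, _, ha⟩ := (hzU u).mp hu
    obtain ⟨b, hb, hb'⟩ := h1 m hm
    refine ⟨a + b, _, hmono a (a + b) (Nat.le_add_right _ _) u ha, z ^ (a + b) * m,
      ⟨M.mul_mem (M.pow_mem hzM _) hm, ?_⟩, by group⟩
    intro u' hu'
    have h := hpow a _ (hb' u' hu')
    have e : (z ^ (a + b) * m) * u' * (z ^ (a + b) * m)⁻¹
        = z ^ a * ((z ^ b * m) * u' * (z ^ b * m)⁻¹) * (z ^ a)⁻¹ := by
      rw [pow_add]; group
    rw [e]; exact h
  refine ⟨h1, h2, le_antisymm ?_ ?_, ?_⟩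
  · rw [Submonoid.closure_le]
    rintro x (hx | hx)
    · exact hx.1
    · rw [Set.mem_singleton_iff.mp hx]; exact M.inv_mem hzM
  · intro m hm
    obtain ⟨n, hn⟩ := h1 m hm
    have e : m = z⁻¹ ^ n * (z ^ n * m) := by rw [inv_pow, inv_mul_cancel_left]
    rw [e]
    refine mul_mem (pow_mem (Submonoid.subset_closure (Set.mem_union_right _ (Set.mem_singleton _))) n)
      (Submonoid.subset_closure (Set.mem_union_left _ hn))
  · rw [eq_top_iff]
    intro g _
    obtain ⟨n, hn⟩ := h2 g
    have e : g = z⁻¹ ^ n * (z ^ n * g) := by rw [inv_pow, inv_mul_cancel_left]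
    rw [e]
    refine mul_mem (pow_mem (Submonoid.subset_closure (Set.mem_union_right _ (Set.mem_singleton _))) n)
      (Submonoid.subset_closure (Set.mem_union_left _ hn))
end

section
/- Let P be a topological group with subgroups U and M such that U is normal in P, P = U·M and U ∩ M = {1}. Let K_U be a compact open subgroup of U, set M⁺ := {m ∈ M : m·K_U·m⁻¹ ⊆ K_U}, and suppose z is an element of the center of M with z·K_U·z⁻¹ ⊆ K_U and U = ⋃_{n>0} z⁻ⁿ·K_U·zⁿ. Let k be a field of characteristic p. Then the set P⁺ := K_U·M⁺ = {u·m : u ∈ K_U, m ∈ M⁺} is a submonoid of P, and the monoid algebra k[P] is flat as a module over the monoid algebra k[P⁺] via the ring homomorphism induced by the inclusion P⁺ ⊆ P; likewise k[M] is flat over k[M⁺]. (In fact, k[P] is the left Ore localization of k[P⁺] at the multiplicative set {zⁿ : n ≥ 0}, and similarly for k[M].) -/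
open scoped TensorProduct

universe v

/-- The set `M⁺` of positive elements of `M` relative to `K_U`. -/
def MplusSet {P : Type*} [Group P] (M K_U : Subgroup P) : Set P :=
  {m : P | m ∈ M ∧ ∀ u ∈ K_U, m * u * m⁻¹ ∈ K_U}

/-- The set `P⁺ = K_U·M⁺`. -/
def PplusSet {P : Type*} [Group P] (M K_U : Subgroup P) : Set P :=
  {g : P | ∃ u ∈ K_U, ∃ m ∈ MplusSet M K_U, g = u * m}

/-- The set of positive elements, viewed inside the group `M`. -/
def MplusSetIn {P : Type*} [Group P] (M K_U : Subgroup P) : Set M :=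
  {m : M | ∀ u ∈ K_U, (m : P) * u * (m : P)⁻¹ ∈ K_U}

/-- For a submonoid `Q` of a monoid `G` and a `k[Q]`-module `V` (encoded as a representation),
the `k`-span of the relations `(x * q) ⊗ v - x ⊗ (q • v)` inside `k[G] ⊗_k V`; the quotient by
this submodule realizes the tensor product `k[G] ⊗_{k[Q]} V` over the (possibly
noncommutative) ring `k[Q]`. -/
noncomputable def inductionRelations {k G : Type*} [Field k] [Monoid G] (Q : Submonoid G)
    {V : Type*} [AddCommGroup V] [Module k V] (ρ : Representation k Q V) :
    Submodule k (MonoidAlgebra k G ⊗[k] V) :=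
  Submodule.span k {t : MonoidAlgebra k G ⊗[k] V |
    ∃ (x : MonoidAlgebra k G) (q : Q) (v : V),
      t = (x * MonoidAlgebra.of k G (q : G)) ⊗ₜ[k] v - x ⊗ₜ[k] ρ q v}

open Classical in
/-- The evaluation map `g ⊗ v ↦ ρ (z ^ n * g) v` (zero if `z ^ n * g ∉ Q`). -/
noncomputable def posEval {k G : Type*} [Field k] [Group G] (Q : Submonoid G)
    {V : Type*} [AddCommGroup V] [Module k V] (ρ : Representation k Q V) (z : G) (n : ℕ) :
    MonoidAlgebra k G ⊗[k] V →ₗ[k] V :=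
  TensorProduct.lift
    ((Finsupp.lift (V →ₗ[k] V) k G
      (fun g => if h : z ^ n * g ∈ Q then ρ ⟨z ^ n * g, h⟩ else 0)) ∘ₗ
        (MonoidAlgebra.coeffLinearEquiv k).toLinearMap)

theorem posEval_single {k G : Type*} [Field k] [Group G] (Q : Submonoid G)
    {V : Type*} [AddCommGroup V] [Module k V] (ρ : Representation k Q V) (z : G) (n : ℕ)
    (g : G) (a : k) (v : V) (h : z ^ n * g ∈ Q) :
    posEval Q ρ z n (MonoidAlgebra.single g a ⊗ₜ[k] v) = a • ρ ⟨z ^ n * g, h⟩ v := by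
  simp [posEval, h]

theorem posEval_natural {k G : Type*} [Field k] [Group G] (Q : Submonoid G)
    {V W : Type*} [AddCommGroup V] [Module k V] [AddCommGroup W] [Module k W]
    (ρV : Representation k Q V) (ρW : Representation k Q W) (φ : V →ₗ[k] W)
    (hφ : ∀ (q : Q) (v : V), φ (ρV q v) = ρW q (φ v)) (z : G) (n : ℕ)
    (t : MonoidAlgebra k G ⊗[k] V) :
    posEval Q ρW z n (LinearMap.lTensor (MonoidAlgebra k G) φ t) = φ (posEval Q ρV z n t) := by
  induction t using TensorProduct.induction_on with
  | zero => simp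
  | add x y hx hy => simp only [map_add, hx, hy]
  | tmul x v =>
    induction x using MonoidAlgebra.induction_linear with
    | zero => simp
    | add x y hx hy => simp only [TensorProduct.add_tmul, map_add, hx, hy]
    | single g a =>
      rw [LinearMap.lTensor_tmul]
      by_cases h : z ^ n * g ∈ Q
      · rw [posEval_single _ _ _ _ _ _ _ h, posEval_single _ _ _ _ _ _ _ h, map_smul, hφ]
      · simp [posEval, h]

theorem posEval_relations {k G : Type*} [Field k] [Group G] (Q : Submonoid G)
    {V : Type*} [AddCommGroup V] [Module k V] (ρ : Representation k Q V) (z : G)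
    (hz : ∀ g : G, ∃ N : ℕ, ∀ n ≥ N, z ^ n * g ∈ Q)
    (t : MonoidAlgebra k G ⊗[k] V) (ht : t ∈ inductionRelations Q ρ) :
    ∃ N : ℕ, ∀ n ≥ N, posEval Q ρ z n t = 0 := by
  unfold inductionRelations at ht
  induction ht using Submodule.span_induction with
  | zero => exact ⟨0, fun n _ => map_zero _⟩
  | add x y _ _ hx hy =>
    obtain ⟨N, hN⟩ := hx
    obtain ⟨N', hN'⟩ := hy
    refine ⟨max N N', fun n hn => ?_⟩
    rw [map_add, hN n (le_trans (le_max_left _ _) hn), hN' n (le_trans (le_max_right _ _) hn),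
      add_zero]
  | smul a x _ hx =>
    obtain ⟨N, hN⟩ := hx
    exact ⟨N, fun n hn => by rw [map_smul, hN n hn, smul_zero]⟩
  | mem t ht =>
    obtain ⟨x, q, v, rfl⟩ := ht
    induction x using MonoidAlgebra.induction_linear with
    | zero => exact ⟨0, fun n _ => by simp⟩
    | add x y hx hy =>
      obtain ⟨N, hN⟩ := hx
      obtain ⟨N', hN'⟩ := hy
      refine ⟨max N N', fun n hn => ?_⟩
      have h1 := hN n (le_trans (le_max_left _ _) hn)
      have h2 := hN' n (le_trans (le_max_right _ _) hn)
      rw [map_sub] at h1 h2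
      rw [add_mul, TensorProduct.add_tmul, TensorProduct.add_tmul, map_sub, map_add, map_add,
        add_sub_add_comm, h1, h2, add_zero]
    | single g a =>
      obtain ⟨N, hN⟩ := hz g
      refine ⟨N, fun n hn => ?_⟩
      have h := hN n hn
      have h' : z ^ n * (g * (q : G)) ∈ Q := by
        rw [← mul_assoc]; exact Q.mul_mem h q.2
      rw [MonoidAlgebra.of_apply, MonoidAlgebra.single_mul_single, mul_one, map_sub,
        posEval_single _ _ _ _ _ _ _ h, posEval_single _ _ _ _ _ _ _ h']
      have : (⟨z ^ n * (g * (q : G)), h'⟩ : Q) = ⟨z ^ n * g, h⟩ * q :=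
        Subtype.ext (mul_assoc _ _ _).symm
      rw [this, map_mul, Module.End.mul_apply, sub_self]

theorem sub_posEval_mem {k G : Type*} [Field k] [Group G] (Q : Submonoid G)
    {V : Type*} [AddCommGroup V] [Module k V] (ρ : Representation k Q V) (z : G)
    (hz : ∀ g : G, ∃ N : ℕ, ∀ n ≥ N, z ^ n * g ∈ Q)
    (t : MonoidAlgebra k G ⊗[k] V) :
    ∃ N : ℕ, ∀ n ≥ N, t - MonoidAlgebra.single (z ^ n)⁻¹ (1 : k) ⊗ₜ[k] posEval Q ρ z n t ∈
      inductionRelations Q ρ := by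
  have key : ∀ x y : MonoidAlgebra k G ⊗[k] V,
      (∃ N : ℕ, ∀ n ≥ N, x - MonoidAlgebra.single (z ^ n)⁻¹ (1 : k) ⊗ₜ[k] posEval Q ρ z n x ∈
        inductionRelations Q ρ) →
      (∃ N : ℕ, ∀ n ≥ N, y - MonoidAlgebra.single (z ^ n)⁻¹ (1 : k) ⊗ₜ[k] posEval Q ρ z n y ∈
        inductionRelations Q ρ) →
      (∃ N : ℕ, ∀ n ≥ N, (x + y) -
        MonoidAlgebra.single (z ^ n)⁻¹ (1 : k) ⊗ₜ[k] posEval Q ρ z n (x + y) ∈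
          inductionRelations Q ρ) := by
    rintro x y ⟨N, hN⟩ ⟨N', hN'⟩
    refine ⟨max N N', fun n hn => ?_⟩
    rw [map_add, TensorProduct.tmul_add, add_sub_add_comm]
    exact Submodule.add_mem _ (hN n (le_trans (le_max_left _ _) hn))
      (hN' n (le_trans (le_max_right _ _) hn))
  induction t using TensorProduct.induction_on with
  | zero => exact ⟨0, fun n _ => by simp⟩
  | add x y hx hy => exact key x y hx hy
  | tmul x v =>
    induction x using MonoidAlgebra.induction_linear with
    | zero => exact ⟨0, fun n _ => by simp⟩
    | add x y hx hy => rw [TensorProduct.add_tmul]; exact key _ _ hx hy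
    | single g a =>
      obtain ⟨N, hN⟩ := hz g
      refine ⟨N, fun n hn => ?_⟩
      have h := hN n hn
      rw [posEval_single _ _ _ _ _ _ _ h]
      refine Submodule.subset_span ⟨MonoidAlgebra.single (z ^ n)⁻¹ a, ⟨z ^ n * g, h⟩, v, ?_⟩
      rw [MonoidAlgebra.of_apply, MonoidAlgebra.single_mul_single, mul_one, inv_mul_cancel_left,
        TensorProduct.tmul_smul, TensorProduct.smul_tmul', MonoidAlgebra.smul_single, smul_eq_mul,
        mul_one]

theorem flat_of_absorbing {k G : Type*} [Field k] [Group G] (Q : Submonoid G) (z : G)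
    (hz : ∀ g : G, ∃ N : ℕ, ∀ n ≥ N, z ^ n * g ∈ Q)
    {V W : Type*} [AddCommGroup V] [Module k V] [AddCommGroup W] [Module k W]
    (ρV : Representation k Q V) (ρW : Representation k Q W) (φ : V →ₗ[k] W)
    (hinj : Function.Injective φ)
    (hφ : ∀ (q : Q) (v : V), φ (ρV q v) = ρW q (φ v))
    (t : MonoidAlgebra k G ⊗[k] V)
    (ht : LinearMap.lTensor (MonoidAlgebra k G) φ t ∈ inductionRelations Q ρW) :
    t ∈ inductionRelations Q ρV := by
  obtain ⟨N, hN⟩ := posEval_relations Q ρW z hz _ ht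
  obtain ⟨N', hN'⟩ := sub_posEval_mem Q ρV z hz t
  have h1 := hN (max N N') (le_max_left _ _)
  have h2 := hN' (max N N') (le_max_right _ _)
  rw [posEval_natural Q ρV ρW φ hφ] at h1
  have h3 := hinj (h1.trans (map_zero φ).symm)
  rwa [h3, TensorProduct.tmul_zero, sub_zero] at h2

theorem conj_pow_mono {P : Type*} [Group P] (K_U : Subgroup P) (z : P)
    (hzpos : ∀ u ∈ K_U, z * u * z⁻¹ ∈ K_U) (u : P) (n m : ℕ) (hnm : n ≤ m)
    (h : z ^ n * u * (z ^ n)⁻¹ ∈ K_U) : z ^ m * u * (z ^ m)⁻¹ ∈ K_U := by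
  induction m, hnm using Nat.le_induction with
  | base => exact h
  | succ m _ ih =>
    have := hzpos _ ih
    rw [pow_succ']
    simpa [mul_assoc] using this

/-- Every element of `M` becomes positive after multiplication by a large power of `z`. -/
theorem exists_pow_mul_positive
    {P : Type*} [Group P] [TopologicalSpace P] [IsTopologicalGroup P]
    (U : Subgroup P) [U.Normal]
    (K_U : Subgroup P) (hKUle : K_U ≤ U) (hKUcpt : IsCompact (K_U : Set P))
    (hKUopen : IsOpen {u : U | (u : P) ∈ K_U})
    (z : P)
    (hzpos : ∀ u ∈ K_U, z * u * z⁻¹ ∈ K_U)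
    (hzU : ∀ g : P, g ∈ U ↔ ∃ n : ℕ, 0 < n ∧ z ^ n * g * (z ^ n)⁻¹ ∈ K_U) (m : P) :
    ∃ N : ℕ, ∀ n ≥ N, ∀ u ∈ K_U, (z ^ n * m) * u * (z ^ n * m)⁻¹ ∈ K_U := by
  have hU : ∀ g : P, ∀ u ∈ U, g * u * g⁻¹ ∈ U := fun g u hu =>
    Subgroup.Normal.conj_mem inferInstance u hu g
  obtain ⟨O, hO, hOK⟩ := isOpen_induced_iff.mp hKUopen
  have hOK' : ∀ u ∈ U, (u ∈ O ↔ u ∈ K_U) := fun u hu => by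
    have := Set.ext_iff.mp hOK ⟨u, hu⟩
    simpa using this
  let f : ℕ → P → P := fun n u => (z ^ n * m) * u * (z ^ n * m)⁻¹
  have hf : ∀ n, Continuous (f n) := fun n => by
    show Continuous fun u => (z ^ n * m) * u * (z ^ n * m)⁻¹
    fun_prop
  have hfe : ∀ n u, f n u = z ^ n * (m * u * m⁻¹) * (z ^ n)⁻¹ := fun n u => by
    simp [f, mul_assoc]
  have hmono : ∀ n n' u, n ≤ n' → f n u ∈ K_U → f n' u ∈ K_U := fun n n' u hn h => by
    rw [hfe] at h ⊢
    exact conj_pow_mono K_U z hzpos _ n n' hn h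
  obtain ⟨s, hs⟩ := hKUcpt.elim_finite_subcover (fun n => f n ⁻¹' O)
    (fun n => hO.preimage (hf n)) (by
      intro u hu
      obtain ⟨n, _, hn⟩ := (hzU (m * u * m⁻¹)).1 (hU m u (hKUle hu))
      rw [Set.mem_iUnion]
      refine ⟨n, ?_⟩
      rw [Set.mem_preimage, hOK' _ (hU _ u (hKUle hu))]
      rw [← hfe] at hn
      exact hn)
  refine ⟨s.sup id, fun n hn u hu => ?_⟩
  have := hs hu
  simp only [Set.mem_iUnion] at this
  obtain ⟨i, hi, hiu⟩ := this
  rw [Set.mem_preimage, hOK' _ (hU _ u (hKUle hu))] at hiu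
  exact hmono i n u (le_trans (Finset.le_sup (f := id) hi) hn) hiu

/-- In the setting of a semidirect product `P = U ⋊ M` of `p`-adic Lie groups with a compact
open subgroup `K_U ⊆ U` and a strictly positive element `z`, the set `P⁺ = K_U·M⁺` is a
submonoid of `P`, and `k[P]` is flat over `k[P⁺]`, likewise `k[M]` is flat over `k[M⁺]`.
Flatness of `k[G]` over `k[Q]` is expressed concretely: for every injective map of
`k[Q]`-modules `φ : V → W`, the induced map `k[G] ⊗_{k[Q]} V → k[G] ⊗_{k[Q]} W` is injective,
where the tensor products are realized as quotients of `k[G] ⊗_k V` by `inductionRelations`. -/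
theorem monoidAlgebra_flat_over_positive_monoid
    {p : ℕ} (hp : p.Prime) (k : Type*) [Field k] [CharP k p]
    {P : Type*} [Group P] [TopologicalSpace P] [IsTopologicalGroup P]
    (U M : Subgroup P) [U.Normal]
    (hP : ∀ g : P, ∃ u ∈ U, ∃ m ∈ M, g = u * m) (hUM : U ⊓ M = ⊥)
    (K_U : Subgroup P) (hKUle : K_U ≤ U) (hKUcpt : IsCompact (K_U : Set P))
    (hKUopen : IsOpen {u : U | (u : P) ∈ K_U})
    (z : P) (hzM : z ∈ M) (hzcentral : ∀ m ∈ M, z * m = m * z)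
    (hzpos : ∀ u ∈ K_U, z * u * z⁻¹ ∈ K_U)
    (hzU : ∀ g : P, g ∈ U ↔ ∃ n : ℕ, 0 < n ∧ z ^ n * g * (z ^ n)⁻¹ ∈ K_U) :
    (∃ Q : Submonoid P, (Q : Set P) = PplusSet M K_U) ∧
    (∀ (V W : Type v) [AddCommGroup V] [Module k V] [AddCommGroup W] [Module k W]
      (ρV : Representation k (Submonoid.closure (PplusSet M K_U)) V)
      (ρW : Representation k (Submonoid.closure (PplusSet M K_U)) W)
      (φ : V →ₗ[k] W), Function.Injective φ →
      (∀ (q : Submonoid.closure (PplusSet M K_U)) (v : V), φ (ρV q v) = ρW q (φ v)) →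
      ∀ t : MonoidAlgebra k P ⊗[k] V,
        LinearMap.lTensor (MonoidAlgebra k P) φ t ∈
            inductionRelations (Submonoid.closure (PplusSet M K_U)) ρW →
          t ∈ inductionRelations (Submonoid.closure (PplusSet M K_U)) ρV) ∧
    (∀ (V W : Type v) [AddCommGroup V] [Module k V] [AddCommGroup W] [Module k W]
      (ρV : Representation k (Submonoid.closure (MplusSetIn M K_U)) V)
      (ρW : Representation k (Submonoid.closure (MplusSetIn M K_U)) W)
      (φ : V →ₗ[k] W), Function.Injective φ →
      (∀ (q : Submonoid.closure (MplusSetIn M K_U)) (v : V), φ (ρV q v) = ρW q (φ v)) →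
      ∀ t : MonoidAlgebra k M ⊗[k] V,
        LinearMap.lTensor (MonoidAlgebra k M) φ t ∈
            inductionRelations (Submonoid.closure (MplusSetIn M K_U)) ρW →
          t ∈ inductionRelations (Submonoid.closure (MplusSetIn M K_U)) ρV) := by
  have hpos := exists_pow_mul_positive U K_U hKUle hKUcpt hKUopen z hzpos hzU
  refine ⟨⟨⟨⟨PplusSet M K_U, ?_⟩, ?_⟩, rfl⟩, ?_, ?_⟩
  · rintro _ _ ⟨u, hu, m, ⟨hm, hmK⟩, rfl⟩ ⟨u', hu', m', ⟨hm', hmK'⟩, rfl⟩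
    refine ⟨u * (m * u' * m⁻¹), K_U.mul_mem hu (hmK u' hu'), m * m', ⟨M.mul_mem hm hm', ?_⟩, ?_⟩
    · intro w hw
      have := hmK _ (hmK' w hw)
      simpa [mul_assoc] using this
    · simp [mul_assoc]
  · exact ⟨1, K_U.one_mem, 1, ⟨M.one_mem, fun u hu => by simpa using hu⟩, by simp⟩
  · intro V W _ _ _ _ ρV ρW φ hinj hφ t ht
    refine flat_of_absorbing _ z (fun g => ?_) ρV ρW φ hinj hφ t ht
    obtain ⟨u, hu, m, hm, rfl⟩ := hP g
    obtain ⟨N, hN⟩ := hpos m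
    obtain ⟨N', _, hN'⟩ := (hzU u).1 hu
    refine ⟨max N N', fun n hn => Submonoid.subset_closure ?_⟩
    refine ⟨z ^ n * u * (z ^ n)⁻¹,
      conj_pow_mono K_U z hzpos u N' n (le_trans (le_max_right _ _) hn) hN', z ^ n * m,
      ⟨M.mul_mem (M.pow_mem hzM n) hm, hN n (le_trans (le_max_left _ _) hn)⟩, ?_⟩
    simp [mul_assoc]
  · intro V W _ _ _ _ ρV ρW φ hinj hφ t ht
    refine flat_of_absorbing _ (⟨z, hzM⟩ : M) (fun g => ?_) ρV ρW φ hinj hφ t ht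
    obtain ⟨N, hN⟩ := hpos (g : P)
    exact ⟨N, fun n hn => Submonoid.subset_closure (hN n hn)⟩
end

section
/- Let P be a group with a normal subgroup U and a subgroup M satisfying M ∩ U = {1}. Let K_M ⊆ M and K_U ⊆ U be subgroups such that K_P := K_M·K_U is a subgroup of P. Then for every g ∈ P: (i) K_P·g·K_U = ⋃_{u ∈ K_U} K_M·u·g·K_U; (ii) for u, u' ∈ K_U, the double cosets K_M·u·g·K_U and K_M·u'·g·K_U have nonempty intersection if and only if u⁻¹·u' ∈ K_U ∩ g·K_U·g⁻¹. In other words, K_P·g·K_U is the disjoint union of the double cosets K_M·u·g·K_U as u ranges over a set of representatives of the left cosets K_U/(K_U ∩ g·K_U·g⁻¹). -/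
/-- Let `P` be a group with a normal subgroup `U` and a subgroup `M` with `M ∩ U = 1`, and let
`K_M ⊆ M`, `K_U ⊆ U` be subgroups such that `K_P = K_M·K_U` is a subgroup.  Then for every
`g ∈ P`: (i) `K_P·g·K_U` is the union of the double cosets `K_M·(u·g)·K_U` for `u ∈ K_U`, and
(ii) two such double cosets `K_M·(u·g)·K_U` and `K_M·(u'·g)·K_U` meet iff
`u⁻¹·u' ∈ K_U ∩ g·K_U·g⁻¹`; so `K_P·g·K_U` is the disjoint union of the `K_M·(u·g)·K_U` with
`u` ranging over representatives of `K_U/(K_U ∩ g·K_U·g⁻¹)`. -/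
theorem double_coset_decomposition
    {P : Type*} [Group P] (U M : Subgroup P) [U.Normal] (hUM : M ⊓ U = ⊥)
    (K_M K_U : Subgroup P) (hKM : K_M ≤ M) (hKU : K_U ≤ U)
    (hKP : ∃ H : Subgroup P, (H : Set P) = {x : P | ∃ a ∈ K_M, ∃ b ∈ K_U, x = a * b})
    (g : P) :
    (∀ x : P,
      (∃ a ∈ K_M, ∃ b ∈ K_U, ∃ c ∈ K_U, x = (a * b) * g * c) ↔
        ∃ u ∈ K_U, ∃ a ∈ K_M, ∃ b ∈ K_U, x = a * (u * g) * b) ∧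
    (∀ u ∈ K_U, ∀ u' ∈ K_U,
      ((∃ x : P,
          (∃ a ∈ K_M, ∃ b ∈ K_U, x = a * (u * g) * b) ∧
          (∃ a ∈ K_M, ∃ b ∈ K_U, x = a * (u' * g) * b)) ↔
        (u⁻¹ * u' ∈ K_U ∧ ∃ w ∈ K_U, u⁻¹ * u' = g * w * g⁻¹))) := by
  refine ⟨fun x => ⟨?_, ?_⟩, fun u hu u' hu' => ⟨?_, ?_⟩⟩
  · rintro ⟨a, ha, b, hb, c, hc, rfl⟩
    exact ⟨b, hb, a, ha, c, hc, by group⟩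
  · rintro ⟨u, hu, a, ha, b, hb, rfl⟩
    exact ⟨a, ha, u, hu, b, hb, by group⟩
  · rintro ⟨x, ⟨a, ha, b, hb, rfl⟩, a', ha', b', hb', h⟩
    refine ⟨K_U.mul_mem (K_U.inv_mem hu) hu', b * b'⁻¹, K_U.mul_mem hb (K_U.inv_mem hb'), ?_⟩
    have e : a'⁻¹ * a = u' * (g * (b' * b⁻¹) * g⁻¹) * u⁻¹ := by
      have h1 : a = a' * (u' * g) * b' * b⁻¹ * (u * g)⁻¹ := by
        rw [← h]; group
      rw [h1]; group
    have hU : a'⁻¹ * a ∈ U := by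
      rw [e]
      exact U.mul_mem (U.mul_mem (hKU hu') (Subgroup.Normal.conj_mem inferInstance _
        (hKU (K_U.mul_mem hb' (K_U.inv_mem hb))) g)) (U.inv_mem (hKU hu))
    have hM : a'⁻¹ * a ∈ M := hKM (K_M.mul_mem (K_M.inv_mem ha') ha)
    have h1 : a'⁻¹ * a ∈ M ⊓ U := ⟨hM, hU⟩
    rw [hUM, Subgroup.mem_bot] at h1
    have h2 : a' = a := inv_mul_eq_one.mp h1
    subst h2
    have h3 : u * g * b = u' * g * b' := by
      rw [mul_assoc a', mul_assoc a'] at h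
      exact mul_left_cancel h
    have h4 : u' = u * g * b * b'⁻¹ * g⁻¹ := by
      rw [h3]; group
    rw [h4]; group
  · rintro ⟨-, w, hw, h⟩
    refine ⟨u' * g, ⟨1, K_M.one_mem, w, hw, ?_⟩, 1, K_M.one_mem, 1, K_U.one_mem, by group⟩
    have h4 : u' = u * (g * w * g⁻¹) := by
      rw [← h]; group
    rw [h4]; group
end

section
/- Let p be a prime, k a field of characteristic p, and n > m ≥ 0 integers. Let G := ℤ/pⁿℤ and let H := pᵐ·(ℤ/pⁿℤ) be the subgroup generated by pᵐ. If an element a of the group algebra k[G] satisfies h·a = a for every h ∈ H (where H acts by left translation, i.e., multiplication by the basis element corresponding to h), then a lies in the kernel of the augmentation map k[G] → k, the k-algebra homomorphism sending every group element to 1. Consequently, the map on H-invariants induced by the augmentation k[G] → k (with trivial action on k) is zero. -/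
/-- Let `k` be a field of characteristic `p` and `n > m ≥ 0`.  If an element `a` of the group
algebra `k[ℤ/pⁿℤ]` is invariant under left translation by every element of the subgroup `H`
generated by `pᵐ`, then `a` lies in the kernel of the augmentation map, i.e. of any `k`-algebra
homomorphism `k[ℤ/pⁿℤ] → k` sending every group element to `1`.  Consequently the map induced
by the augmentation on `H`-invariants is zero. -/
theorem augmentation_vanishes_on_invariants
    {p : ℕ} (hp : p.Prime) (k : Type*) [Field k] [CharP k p]
    (n m : ℕ) (hmn : m < n)
    (a : AddMonoidAlgebra k (ZMod (p ^ n)))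
    (ha : ∀ h ∈ AddSubgroup.zmultiples ((p : ZMod (p ^ n)) ^ m),
      AddMonoidAlgebra.single h (1 : k) * a = a)
    (aug : AddMonoidAlgebra k (ZMod (p ^ n)) →ₐ[k] k)
    (haug : ∀ g : ZMod (p ^ n), aug (AddMonoidAlgebra.single g 1) = 1) :
    aug a = 0 := by
  have : NeZero (p ^ n) := ⟨pow_ne_zero _ hp.ne_zero⟩
  set H := AddSubgroup.zmultiples ((p : ZMod (p ^ n)) ^ m) with hH
  have hcard : ((Nat.card H : ℕ) : k) = 0 := by
    rw [CharP.cast_eq_zero_iff k p, hH, Nat.card_zmultiples]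
    have h1 : ((p : ZMod (p ^ n)) ^ m) = ((p ^ m : ℕ) : ZMod (p ^ n)) := by push_cast; rfl
    rw [h1, ZMod.addOrderOf_coe _ (pow_ne_zero _ hp.ne_zero),
      Nat.gcd_eq_right (pow_dvd_pow p hmn.le), Nat.pow_div hmn.le hp.pos]
    exact dvd_pow_self p (by omega)
  have hinv : ∀ h ∈ H, ∀ g, a.coeff (g + h) = a.coeff g := by
    intro h hh g
    conv_lhs => rw [← ha h hh]
    rw [add_comm g h, AddMonoidAlgebra.coeff_single_mul_eq_mul_coeff g (by simp)]
    simp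
  have hsum : aug a = ∑ g, a.coeff g := by
    have key : ∀ b : AddMonoidAlgebra k (ZMod (p ^ n)), aug b = ∑ g, b.coeff g := by
      intro b
      induction b using AddMonoidAlgebra.induction_linear with
      | zero => simp
      | add f g hf hg => simp [hf, hg, Finset.sum_add_distrib]
      | single g r =>
        have : AddMonoidAlgebra.single g r = r • AddMonoidAlgebra.single g (1 : k) := by simp
        rw [this, map_smul, haug]
        simp [Finsupp.single_apply]
    exact key a
  classical
  have : Fintype H := Fintype.ofFinite _
  have : Fintype (ZMod (p ^ n) ⧸ H) := Fintype.ofFinite _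
  have hmk : ∀ (q : ZMod (p ^ n) ⧸ H) (h : H),
      ((q.out + h.1 : ZMod (p ^ n)) : ZMod (p ^ n) ⧸ H) = q := by
    intro q h
    rw [QuotientAddGroup.mk_add_of_mem _ h.2, QuotientAddGroup.out_eq']
  have hbij : Function.Bijective
      (fun x : (ZMod (p ^ n) ⧸ H) × H => (x.1.out + x.2.1 : ZMod (p ^ n))) := by
    constructor
    · rintro ⟨q, h⟩ ⟨q', h'⟩ e
      have e1 : q.out + h.1 = q'.out + h'.1 := e
      have hq : q = q' := by rw [← hmk q h, ← hmk q' h', e1]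
      subst hq
      have := Subtype.ext (add_left_cancel e1)
      rw [this]
    · intro g
      refine ⟨((g : ZMod (p ^ n) ⧸ H), ⟨-(g : ZMod (p ^ n) ⧸ H).out + g, ?_⟩), ?_⟩
      · rw [← QuotientAddGroup.eq, QuotientAddGroup.out_eq']
      · simp
  rw [hsum, ← hbij.sum_comp, Fintype.sum_prod_type]
  refine Finset.sum_eq_zero fun q _ => ?_
  rw [Finset.sum_congr rfl fun (h : H) _ => hinv h.1 h.2 q.out, Finset.sum_const, Finset.card_univ,
    ← Nat.card_eq_fintype_card, nsmul_eq_mul, hcard, zero_mul]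
end
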